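/- arXiv:2312.10644 — 7 statements merged into one kernel-verified Lean document; each statement's English description precedes it below -/
import Mathlib

section
/- Let φ be a cutoff function, p ∈ ℂ, and k ∈ ℕ. Then the function x ↦ φ(x) x^{−p} (log x)^k on (0,∞) has a Mellin transform m(z) that converges absolutely for Re z > Re p, and there exists an entire function g : ℂ → ℂ such that for every z ∈ ℂ with Re z > Re p, m(z) = (−1)^k · k! / (z − p)^{k+1} + g(z). In particular m is holomorphic on {z : Re z > Re p} and extends meromorphically to ℂ with a single pole, at z = p, of order k + 1 and principal part (−1)^k k! (z − p)^{−(k+1)}. -/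
open Set MeasureTheory

open Filter Asymptotics Topology

theorem locallyIntegrableOn_indicator_Ioi {f : ℝ → ℂ} (hf : ContinuousOn f (Ioi 0)) {s : Set ℝ}
    (hs : MeasurableSet s) : LocallyIntegrableOn (s.indicator f) (Ioi 0) := by
  intro x hx
  obtain ⟨U, hU, hfU⟩ := hf.locallyIntegrableOn (μ := volume) measurableSet_Ioi x hx
  exact ⟨U, hU, hfU.indicator hs⟩

theorem continuousOn_ofReal_log_pow (k : ℕ) :
    ContinuousOn (fun t : ℝ => (Real.log t : ℂ) ^ k) (Ioi 0) :=
  (Complex.continuous_ofReal.comp_continuousOn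
    (Real.continuousOn_log.mono fun _ hx => ne_of_gt hx)).pow k

theorem log_smul_indicator_log_pow (k : ℕ) :
    (fun t : ℝ => Real.log t • (Ioc 0 1).indicator (fun t : ℝ => (Real.log t : ℂ) ^ k) t) =
      (Ioc 0 1).indicator fun t : ℝ => (Real.log t : ℂ) ^ (k + 1) := by
  ext t
  by_cases ht : t ∈ Ioc (0 : ℝ) 1
  · simp only [indicator_of_mem ht, Complex.real_smul, pow_succ']
  · simp only [indicator_of_notMem ht, smul_zero]

theorem isBigO_indicator_log_pow (k : ℕ) {b : ℝ} (hb : 0 < b) :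
    (Ioc 0 1).indicator (fun t : ℝ => (Real.log t : ℂ) ^ k) =O[𝓝[>] 0] (· ^ (-b)) := by
  induction k generalizing b with
  | zero =>
    refine IsBigO.of_bound 1 ?_
    filter_upwards [Ioc_mem_nhdsGT (zero_lt_one' ℝ)] with t ht
    rw [indicator_of_mem ht, pow_zero, norm_one, one_mul]
    exact (Real.one_le_rpow_of_pos_of_le_one_of_nonpos ht.1 ht.2 (neg_nonpos.2 hb.le)).trans
      (Real.le_norm_self _)
  | succ k ih =>
    rw [← log_smul_indicator_log_pow]
    exact isBigO_rpow_zero_log_smul (half_lt_self hb) (ih (half_pos hb))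

theorem eventuallyEq_zero_isBigO {l : Filter ℝ} {f : ℝ → ℂ} (hf : f =ᶠ[l] 0) (g : ℝ → ℝ) :
    f =O[l] g :=
  hf.trans_isBigO (isBigO_zero g l)

theorem indicator_Ioc_eventuallyEq_zero (f : ℝ → ℂ) :
    (Ioc 0 1).indicator f =ᶠ[atTop] 0 := by
  filter_upwards [eventually_gt_atTop 1] with t ht
  exact indicator_of_notMem (fun h => not_le_of_gt ht h.2) f

/-- The Mellin transform of `(log t) ^ k` restricted to `Ioc 0 1`. -/
theorem hasMellin_log_pow_Ioc (k : ℕ) {s : ℂ} (hs : 0 < s.re) :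
    HasMellin ((Ioc 0 1).indicator fun t : ℝ => (Real.log t : ℂ) ^ k) s
      ((-1) ^ k * (Nat.factorial k : ℂ) / s ^ (k + 1)) := by
  induction k generalizing s with
  | zero => simpa using hasMellin_one_Ioc hs
  | succ k ih =>
    obtain ⟨hconv, hderiv⟩ := mellin_hasDerivAt_of_isBigO_rpow
      (locallyIntegrableOn_indicator_Ioi (continuousOn_ofReal_log_pow k) measurableSet_Ioc)
      (eventuallyEq_zero_isBigO (indicator_Ioc_eventuallyEq_zero _) _) (lt_add_one s.re)
      (isBigO_indicator_log_pow k (half_pos hs)) (half_lt_self hs)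
    rw [log_smul_indicator_log_pow] at hconv hderiv
    refine ⟨hconv, hderiv.unique ?_⟩
    have hs0 : s ≠ 0 := by
      rintro rfl
      simp at hs
    have hpow := ((hasDerivAt_pow (k + 1) s).inv (pow_ne_zero _ hs0)).const_mul
      ((-1) ^ k * (Nat.factorial k : ℂ))
    have heq : mellin ((Ioc 0 1).indicator fun t : ℝ => (Real.log t : ℂ) ^ k) =ᶠ[𝓝 s]
        fun z => (-1) ^ k * (Nat.factorial k : ℂ) * (z ^ (k + 1))⁻¹ := by
      filter_upwards [(isOpen_lt continuous_const Complex.continuous_re).mem_nhds hs] with z hz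
      rw [(ih hz).2, div_eq_mul_inv]
    refine (hpow.congr_deriv ?_).congr_of_eventuallyEq heq
    rw [Nat.factorial_succ]
    push_cast
    field_simp
    ring

/-- A locally integrable function on `(0, ∞)` vanishing near `0` and near `∞` has an
everywhere convergent, entire Mellin transform. -/
theorem mellin_entire_of_eventuallyEq_zero {f : ℝ → ℂ} (hf : LocallyIntegrableOn f (Ioi 0))
    (htop : f =ᶠ[atTop] 0) (hbot : f =ᶠ[𝓝[>] 0] 0) :
    (∀ s, MellinConvergent f s) ∧ Differentiable ℂ (mellin f) :=
  ⟨fun s => mellinConvergent_of_isBigO_rpow hf (eventuallyEq_zero_isBigO htop _)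
      (lt_add_one s.re) (eventuallyEq_zero_isBigO hbot _) (sub_one_lt s.re),
    fun s => mellin_differentiableAt_of_isBigO_rpow hf (eventuallyEq_zero_isBigO htop _)
      (lt_add_one s.re) (eventuallyEq_zero_isBigO hbot _) (sub_one_lt s.re)⟩

/-- The Mellin transform of `φ(x) x^{-p} (log x)^k` (with `φ` a cutoff function) converges
absolutely for `Re z > Re p`, and equals `(-1)^k k!/(z-p)^{k+1}` plus an entire function
there; in particular it extends meromorphically to `ℂ` with a single pole at `z = p`
of order `k+1` and principal part `(-1)^k k! (z-p)^{-(k+1)}`. -/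
theorem mellin_cutoff_pow_log_pole
    (φ : ℝ → ℝ) (hφ : ContDiff ℝ (⊤ : ℕ∞) φ)
    (hφ0 : ∀ x, 0 ≤ φ x) (hφ1 : ∀ x, φ x ≤ 1)
    (hφone : ∀ x : ℝ, x ≤ 1 → φ x = 1) (hφzero : ∀ x : ℝ, 2 ≤ x → φ x = 0)
    (p : ℂ) (k : ℕ) :
    (∀ z : ℂ, p.re < z.re →
      MellinConvergent (fun x : ℝ => (φ x : ℂ) * (x : ℂ) ^ (-p) * (Real.log x : ℂ) ^ k) z) ∧
    ∃ g : ℂ → ℂ, Differentiable ℂ g ∧ ∀ z : ℂ, p.re < z.re →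
      mellin (fun x : ℝ => (φ x : ℂ) * (x : ℂ) ^ (-p) * (Real.log x : ℂ) ^ k) z
        = (-1) ^ k * (Nat.factorial k : ℂ) / (z - p) ^ (k + 1) + g z := by
  set L : ℝ → ℂ := (Ioc 0 1).indicator fun t : ℝ => (Real.log t : ℂ) ^ k with hL
  set h : ℝ → ℂ := (Ioi 1).indicator fun t : ℝ => (φ t : ℂ) * (Real.log t : ℂ) ^ k with hh
  obtain ⟨hconv, hdiff⟩ : (∀ s, MellinConvergent h s) ∧ Differentiable ℂ (mellin h) := by
    refine mellin_entire_of_eventuallyEq_zero (locallyIntegrableOn_indicator_Ioi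
      ((Complex.continuous_ofReal.comp hφ.continuous).continuousOn.mul
        (continuousOn_ofReal_log_pow k)) measurableSet_Ioi) ?_ ?_
    · filter_upwards [eventually_ge_atTop 2] with t ht
      simp [hh, indicator_apply, hφzero t ht]
    · filter_upwards [Ioc_mem_nhdsGT (zero_lt_one' ℝ)] with t ht
      exact indicator_of_notMem (not_lt_of_ge ht.2) _
  have hsplit : ∀ t ∈ Ioi (0 : ℝ), (φ t : ℂ) * (t : ℂ) ^ (-p) * (Real.log t : ℂ) ^ k =
      (t : ℂ) ^ (-p) • (L t + h t) := by
    intro t ht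
    rcases le_or_gt t 1 with h1 | h1
    · rw [hL, hh, indicator_of_mem (show t ∈ Ioc 0 1 from ⟨ht, h1⟩),
        indicator_of_notMem (show t ∉ Ioi 1 from not_lt_of_ge h1), hφone t h1]
      simp
    · rw [hL, hh, indicator_of_notMem (show t ∉ Ioc 0 1 from fun h' => not_le_of_gt h1 h'.2),
        indicator_of_mem (show t ∈ Ioi 1 from h1), smul_eq_mul]
      ring
  have hmellin : ∀ z : ℂ, p.re < z.re →
      HasMellin (fun x : ℝ => (φ x : ℂ) * (x : ℂ) ^ (-p) * (Real.log x : ℂ) ^ k) z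
        ((-1) ^ k * (Nat.factorial k : ℂ) / (z - p) ^ (k + 1) + mellin h (z - p)) := by
    intro z hz
    have hlog := hasMellin_log_pow_Ioc k (s := z - p) (by simpa using hz)
    have hadd := hasMellin_add hlog.1 (hconv (z - p))
    rw [hlog.2] at hadd
    rw [sub_eq_add_neg] at hadd ⊢
    constructor
    · refine (integrableOn_congr_fun (fun t ht => ?_) measurableSet_Ioi).2
        (MellinConvergent.cpow_smul.2 hadd.1)
      simp only [hsplit t ht, hL]
    · rw [← hadd.2, ← mellin_cpow_smul]
      refine setIntegral_congr_fun measurableSet_Ioi fun t ht => ?_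
      simp only [hsplit t ht, hL]
  exact ⟨fun z hz => (hmellin z hz).1, fun z => mellin h (z - p),
    hdiff.comp (differentiable_id.sub_const p), fun z hz => (hmellin z hz).2⟩
end

section
/- Let φ be a cutoff function, p ∈ ℂ, and k ∈ ℕ, and let m(z) = ∫₀^∞ x^{z−1} φ(x) x^{−p} (log x)^k dx for Re z > Re p. Then m decays rapidly on every vertical line to the right of Re p: for every β ∈ ℝ with β > Re p and every M ∈ ℕ, sup_{τ ∈ ℝ} (1 + |τ|)^M · |m(β + iτ)| < ∞. -/
open Set MeasureTheory Complex

open Filter Topology Asymptotics in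
/-- A continuous function vanishing near `-∞` and bounded near `+∞`, times a power and a
decaying complex exponential, is integrable. -/
lemma integrable_cexp_neg_mul_pow_mul {ψ : ℝ → ℝ} (hc : Continuous ψ)
    (hbot : ψ =ᶠ[atBot] 0) {c : ℝ} (htop : ψ =ᶠ[atTop] fun _ => c) (k : ℕ)
    {w : ℂ} (hw : 0 < w.re) :
    Integrable fun t : ℝ => cexp (-w * t) * ((t : ℂ) ^ k * (ψ t : ℂ)) := by
  have hcont : Continuous fun t : ℝ => cexp (-w * t) * ((t : ℂ) ^ k * (ψ t : ℂ)) := by fun_prop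
  refine hcont.locallyIntegrable.integrable_of_isBigO_atBot_atTop (g := fun _ => (0 : ℝ))
    (g' := fun t : ℝ => Real.exp (-(w.re / 2) * t)) ?_
    ⟨univ, univ_mem, integrableOn_zero⟩ ?_
    ⟨Ioi 0, Ioi_mem_atTop 0, exp_neg_integrableOn_Ioi 0 (half_pos hw)⟩
  · have h0 : (fun t : ℝ => cexp (-w * t) * ((t : ℂ) ^ k * (ψ t : ℂ))) =ᶠ[atBot]
        fun _ => (0 : ℂ) := by
      filter_upwards [hbot] with t ht
      simp [ht]
    exact h0.trans_isBigO (isBigO_zero _ _)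
  · have h1 : (fun t : ℝ => Real.exp (-w.re * t) * (t ^ k * ψ t)) =O[atTop]
        fun t : ℝ => Real.exp (-w.re * t) * (Real.exp (w.re / 2 * t) * 1) := by
      refine (isBigO_refl _ _).mul
        ((isLittleO_pow_exp_pos_mul_atTop k (half_pos hw)).isBigO.mul ?_)
      exact htop.trans_isBigO (isBigO_const_const c one_ne_zero _)
    have h2 : (fun t : ℝ => Real.exp (-w.re * t) * (Real.exp (w.re / 2 * t) * 1)) =
        fun t : ℝ => Real.exp (-(w.re / 2) * t) := by
      funext t
      rw [mul_one, ← Real.exp_add]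
      ring_nf
    rw [h2] at h1
    refine IsBigO.trans (IsBigO.of_norm_eventuallyLE (Eventually.of_forall fun t => ?_)) h1.norm_left
    simp [Complex.norm_exp]

open Filter in
lemma integral_cexp_neg_mul_pow_mul_by_parts {ψ : ℝ → ℝ} (hψ : ContDiff ℝ (⊤ : ℕ∞) ψ)
    (hbot : ψ =ᶠ[atBot] 0) {c : ℝ} (htop : ψ =ᶠ[atTop] fun _ => c)
    (hbot' : deriv ψ =ᶠ[atBot] 0) {c' : ℝ} (htop' : deriv ψ =ᶠ[atTop] fun _ => c') (k : ℕ)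
    {w : ℂ} (hw : 0 < w.re) :
    w * ∫ t : ℝ, cexp (-w * t) * ((t : ℂ) ^ k * (ψ t : ℂ)) =
      k * (∫ t : ℝ, cexp (-w * t) * ((t : ℂ) ^ (k - 1) * (ψ t : ℂ))) +
        ∫ t : ℝ, cexp (-w * t) * ((t : ℂ) ^ k * ((deriv ψ t : ℝ) : ℂ)) := by
  have i0 := integrable_cexp_neg_mul_pow_mul hψ.continuous hbot htop k hw
  have i1 := integrable_cexp_neg_mul_pow_mul hψ.continuous hbot htop (k - 1) hw
  have i2 := integrable_cexp_neg_mul_pow_mul (hψ.continuous_deriv (by simp)) hbot' htop' k hw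
  have key := integral_eq_zero_of_hasDerivAt_of_integrable (fun t => ?_)
    (((i1.const_mul (k : ℂ)).add i2).sub (i0.const_mul w)) i0
  · rw [integral_sub' ((i1.const_mul (k : ℂ)).add i2) (i0.const_mul w),
      integral_add' (i1.const_mul (k : ℂ)) i2, integral_const_mul, integral_const_mul] at key
    exact (sub_eq_zero.mp key).symm
  · have hd : HasDerivAt ψ (deriv ψ t) t := (hψ.differentiable (by simp) t).hasDerivAt
    have hid : HasDerivAt (fun t : ℝ => (t : ℂ)) 1 t := Complex.ofRealCLM.hasDerivAt
    have h := ((hid.const_mul (-w)).cexp).mul ((hid.pow k).mul hd.ofReal_comp)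
    refine h.congr_deriv ?_
    simp only [Pi.add_apply, Pi.sub_apply, Pi.mul_apply, Pi.pow_apply]
    ring

open Filter Topology in
lemma deriv_eventuallyEq_atTop_of_eventuallyEq_const {ψ : ℝ → ℝ} {c : ℝ}
    (h : ψ =ᶠ[atTop] fun _ => c) : deriv ψ =ᶠ[atTop] fun _ => 0 := by
  obtain ⟨T, hT⟩ := eventually_atTop.mp h
  filter_upwards [eventually_gt_atTop T] with t ht
  have : ψ =ᶠ[𝓝 t] fun _ => c := by
    filter_upwards [Ioi_mem_nhds ht] with s hs using hT s (le_of_lt hs)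
  simp [this.deriv_eq]

open Filter Topology in
lemma deriv_eventuallyEq_atBot_of_eventuallyEq_zero {ψ : ℝ → ℝ}
    (h : ψ =ᶠ[atBot] 0) : deriv ψ =ᶠ[atBot] 0 := by
  obtain ⟨T, hT⟩ := eventually_atBot.mp h
  filter_upwards [eventually_lt_atBot T] with t ht
  have : ψ =ᶠ[𝓝 t] fun _ => 0 := by
    filter_upwards [Iio_mem_nhds ht] with s hs using hT s (le_of_lt hs)
  simp [this.deriv_eq]

open Filter in
/-- The Laplace transform of `t ^ k * ψ t`, for a smooth `ψ` which vanishes near `-∞` and is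
constant near `+∞`, decays rapidly on vertical lines in the right half plane. -/
lemma exists_norm_pow_mul_norm_integral_cexp_le {a : ℝ} (ha : 0 < a) (M : ℕ) :
    ∀ (k : ℕ) (ψ : ℝ → ℝ) (c : ℝ), ContDiff ℝ (⊤ : ℕ∞) ψ → ψ =ᶠ[atBot] 0 →
      (ψ =ᶠ[atTop] fun _ => c) → ∃ C : ℝ, ∀ w : ℂ, w.re = a →
        ‖w‖ ^ M * ‖∫ t : ℝ, cexp (-w * t) * ((t : ℂ) ^ k * (ψ t : ℂ))‖ ≤ C := by
  induction M with
  | zero =>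
    intro k ψ c _ _ _
    refine ⟨∫ t : ℝ, Real.exp (-a * t) * (|t| ^ k * |ψ t|), fun w hw => ?_⟩
    rw [pow_zero, one_mul]
    refine (norm_integral_le_integral_norm _).trans_eq (integral_congr_ae (.of_forall fun t => ?_))
    simp [Complex.norm_exp, hw]
  | succ M ih =>
    intro k ψ c hψ hbot htop
    have hbot' := deriv_eventuallyEq_atBot_of_eventuallyEq_zero hbot
    have htop' := deriv_eventuallyEq_atTop_of_eventuallyEq_const htop
    have hψ' : ContDiff ℝ (⊤ : ℕ∞) (deriv ψ) := (contDiff_infty_iff_deriv.mp hψ).2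
    obtain ⟨C₁, h₁⟩ := ih (k - 1) ψ c hψ hbot htop
    obtain ⟨C₂, h₂⟩ := ih k (deriv ψ) 0 hψ' hbot' htop'
    refine ⟨k * C₁ + C₂, fun w hw => ?_⟩
    rw [pow_succ, mul_assoc, ← norm_mul,
      integral_cexp_neg_mul_pow_mul_by_parts hψ hbot htop hbot' htop' k (hw ▸ ha)]
    calc _ ≤ ‖w‖ ^ M * (k * ‖∫ t : ℝ, cexp (-w * t) * ((t : ℂ) ^ (k - 1) * (ψ t : ℂ))‖ +
          ‖∫ t : ℝ, cexp (-w * t) * ((t : ℂ) ^ k * ((deriv ψ t : ℝ) : ℂ))‖) := by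
          gcongr
          refine (norm_add_le _ _).trans_eq ?_
          rw [norm_mul, Complex.norm_natCast]
      _ = k * (‖w‖ ^ M * ‖∫ t : ℝ, cexp (-w * t) * ((t : ℂ) ^ (k - 1) * (ψ t : ℂ))‖) +
          ‖w‖ ^ M * ‖∫ t : ℝ, cexp (-w * t) * ((t : ℂ) ^ k * ((deriv ψ t : ℝ) : ℂ))‖ := by ring
      _ ≤ k * C₁ + C₂ := by gcongr; exacts [h₁ w hw, h₂ w hw]

lemma integral_Ioi_eq_integral_comp_exp_neg {E : Type*} [NormedAddCommGroup E] [NormedSpace ℝ E]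
    (f : ℝ → E) :
    ∫ x in Ioi (0 : ℝ), f x = ∫ t : ℝ, Real.exp (-t) • f (Real.exp (-t)) := by
  have him : (fun t : ℝ => Real.exp (-t)) '' univ = Ioi 0 := by
    rw [← Real.range_exp, image_univ]
    exact neg_surjective.range_comp Real.exp
  have hd : ∀ t ∈ (univ : Set ℝ),
      HasDerivWithinAt (fun t : ℝ => Real.exp (-t)) (-Real.exp (-t)) univ t := fun t _ => by
    exact ((hasDerivAt_neg t).exp.congr_deriv (by ring)).hasDerivWithinAt
  rw [← him, integral_image_eq_integral_abs_deriv_smul MeasurableSet.univ hd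
    (fun x _ y _ h => neg_injective (Real.exp_injective h))]
  simp

lemma ofReal_exp_cpow (t : ℝ) (z : ℂ) : ((Real.exp t : ℝ) : ℂ) ^ z = cexp (t * z) := by
  rw [cpow_def_of_ne_zero (by exact_mod_cast (Real.exp_pos t).ne'),
    ← Complex.ofReal_log (Real.exp_pos t).le, Real.log_exp]

/-- The Mellin transform `m(z) = ∫₀^∞ x^{z-1} φ(x) x^{-p} (log x)^k dx` of an asymptotic
term decays rapidly on every vertical line `Re z = β` with `β > Re p`. -/
theorem mellin_cutoff_pow_log_rapid_decay
    (φ : ℝ → ℝ) (hφ : ContDiff ℝ (⊤ : ℕ∞) φ)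
    (hφ0 : ∀ x, 0 ≤ φ x) (hφ1 : ∀ x, φ x ≤ 1)
    (hφone : ∀ x : ℝ, x ≤ 1 → φ x = 1) (hφzero : ∀ x : ℝ, 2 ≤ x → φ x = 0)
    (p : ℂ) (k : ℕ) (β : ℝ) (hβ : p.re < β) (M : ℕ) :
    ∃ C : ℝ, ∀ τ : ℝ,
      (1 + |τ|) ^ M *
        ‖∫ x in Ioi (0 : ℝ), (x : ℂ) ^ (((β : ℂ) + τ * I) - 1) *
          ((φ x : ℂ) * (x : ℂ) ^ (-p) * (Real.log x : ℂ) ^ k)‖ ≤ C := by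
  have ha : 0 < β - p.re := sub_pos.mpr hβ
  have hsmooth : ContDiff ℝ (⊤ : ℕ∞) fun t : ℝ => φ (Real.exp (-t)) :=
    hφ.comp (Real.contDiff_exp.comp contDiff_neg)
  have hbot : (fun t : ℝ => φ (Real.exp (-t))) =ᶠ[Filter.atBot] 0 := by
    filter_upwards [Filter.eventually_le_atBot (-1)] with t ht
    refine hφzero _ ?_
    linarith [Real.add_one_le_exp (-t)]
  have htop : (fun t : ℝ => φ (Real.exp (-t))) =ᶠ[Filter.atTop] fun _ => 1 := by
    filter_upwards [Filter.eventually_ge_atTop 0] with t ht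
    exact hφone _ (Real.exp_le_one_iff.mpr (by linarith))
  obtain ⟨C, hC⟩ := exists_norm_pow_mul_norm_integral_cexp_le ha M k _ 1 hsmooth hbot htop
  set K : ℝ := 1 + (1 + |p.im|) / (β - p.re) with hK
  refine ⟨K ^ M * C, fun τ => ?_⟩
  set w : ℂ := β + τ * I - p with hw
  have hre : w.re = β - p.re := by simp [hw]
  have him : w.im = τ - p.im := by simp [hw]
  have hτ : 1 + |τ| ≤ K * ‖w‖ := by
    have h1 : |τ| ≤ ‖w‖ + |p.im| := by
      have := abs_add_le w.im p.im
      rw [him, sub_add_cancel, ← him] at this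
      linarith [Complex.abs_im_le_norm w]
    have h2 : β - p.re ≤ ‖w‖ := hre ▸ Complex.re_le_norm w
    have h3 : 1 + |p.im| ≤ (1 + |p.im|) / (β - p.re) * ‖w‖ := by
      rw [div_mul_eq_mul_div, le_div_iff₀ ha]
      gcongr
    rw [hK, add_mul]
    linarith
  have hint : ‖∫ x in Ioi (0 : ℝ), (x : ℂ) ^ (((β : ℂ) + τ * I) - 1) *
      ((φ x : ℂ) * (x : ℂ) ^ (-p) * (Real.log x : ℂ) ^ k)‖ =
      ‖∫ t : ℝ, cexp (-w * t) * ((t : ℂ) ^ k * (φ (Real.exp (-t)) : ℂ))‖ := by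
    rw [integral_Ioi_eq_integral_comp_exp_neg]
    have : ∀ t : ℝ, Real.exp (-t) • (((Real.exp (-t) : ℝ) : ℂ) ^ (((β : ℂ) + τ * I) - 1) *
        ((φ (Real.exp (-t)) : ℂ) * ((Real.exp (-t) : ℝ) : ℂ) ^ (-p) *
          (Real.log (Real.exp (-t)) : ℂ) ^ k)) =
        (-1) ^ k * (cexp (-w * t) * ((t : ℂ) ^ k * (φ (Real.exp (-t)) : ℂ))) := fun t => by
      have hexp : cexp (-w * t) = cexp ((-t : ℝ) : ℂ) *
          cexp ((-t : ℝ) * (((β : ℂ) + τ * I) - 1)) * cexp ((-t : ℝ) * (-p)) := by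
        rw [← Complex.exp_add, ← Complex.exp_add, hw]
        push_cast
        ring_nf
      rw [ofReal_exp_cpow, ofReal_exp_cpow, Real.log_exp, Complex.real_smul, Complex.ofReal_exp,
        hexp, Complex.ofReal_neg t, neg_pow (t : ℂ) k]
      ring
    simp_rw [this]
    rw [integral_const_mul, norm_mul]
    simp
  rw [hint]
  calc _ ≤ (K * ‖w‖) ^ M *
        ‖∫ t : ℝ, cexp (-w * t) * ((t : ℂ) ^ k * (φ (Real.exp (-t)) : ℂ))‖ := by gcongr
    _ = K ^ M * (‖w‖ ^ M *
        ‖∫ t : ℝ, cexp (-w * t) * ((t : ℂ) ^ k * (φ (Real.exp (-t)) : ℂ))‖) := by rw [mul_pow, mul_assoc]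
    _ ≤ K ^ M * C := by gcongr; exact hC w hre
end

section
/- Let φ be a cutoff function and p ∈ ℂ, and let m : ℂ → ℂ be given by m(z) = ∫₀^∞ x^{z−1} φ(x) x^{−p} dx (so m is holomorphic on {z : Re z > Re p}). Then for every k ∈ ℕ there exists an entire function G : ℂ → ℂ such that G(z) = (z − p)^{k+1} · m^{(k)}(z) for all z with Re z > Re p; that is, (z − p)^{k+1} m^{(k)}(z) extends holomorphically to all of ℂ. -/
open Set MeasureTheory

/-- The Mellin transform of a locally integrable function vanishing near zero and near infinity is
entire. -/
theorem differentiable_mellin_of_eventually_eq_zero {f : ℝ → ℂ}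
    (hf : LocallyIntegrableOn f (Ioi 0)) (h_top : ∀ᶠ x in Filter.atTop, f x = 0)
    (h_zero : ∀ᶠ x in nhdsWithin 0 (Ioi 0), f x = 0) (s : ℂ) :
    MellinConvergent f s ∧ DifferentiableAt ℂ (mellin f) s := by
  have htop : f =O[Filter.atTop] fun x : ℝ => x ^ (-(s.re + 1)) :=
    (Asymptotics.isBigO_zero _ _).congr' (h_top.mono fun x hx => hx.symm) Filter.EventuallyEq.rfl
  have hbot : f =O[nhdsWithin 0 (Ioi 0)] fun x : ℝ => x ^ (-(s.re - 1)) :=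
    (Asymptotics.isBigO_zero _ _).congr' (h_zero.mono fun x hx => hx.symm) Filter.EventuallyEq.rfl
  exact ⟨mellinConvergent_of_isBigO_rpow hf htop (by linarith) hbot (by linarith),
    mellin_differentiableAt_of_isBigO_rpow hf htop (by linarith) hbot (by linarith)⟩

/-- If `(z - p) m(z)` agrees with an entire function on the half-plane `Re z > Re p`, then so does
`(z - p)^{k+1} m^{(k)}(z)`. -/
theorem exists_entire_eq_pow_mul_iteratedDeriv {m F : ℂ → ℂ} {p : ℂ} (hF : Differentiable ℂ F)
    (h : ∀ z : ℂ, p.re < z.re → F z = (z - p) * m z) (k : ℕ) :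
    ∃ G : ℂ → ℂ, Differentiable ℂ G ∧
      ∀ z : ℂ, p.re < z.re → G z = (z - p) ^ (k + 1) * iteratedDeriv k m z := by
  induction k with
  | zero => exact ⟨F, hF, by simpa using h⟩
  | succ k ih =>
    obtain ⟨G, hG, hGm⟩ := ih
    refine ⟨fun z => (z - p) * deriv G z - (k + 1) * G z, ?_, fun z hz => ?_⟩
    · have hG' : Differentiable ℂ (deriv G) := fun z => (hG.analyticAt z).deriv.differentiableAt
      fun_prop
    have hnhds : ∀ᶠ w in nhds z, p.re < w.re :=
      Complex.continuous_re.continuousAt.eventually (lt_mem_nhds hz)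
    have hne : ∀ w : ℂ, p.re < w.re → w - p ≠ 0 := fun w hw h0 => by
      rw [sub_eq_zero.mp h0] at hw
      exact lt_irrefl _ hw
    have heq : iteratedDeriv k m =ᶠ[nhds z] fun w => G w / (w - p) ^ (k + 1) := by
      filter_upwards [hnhds] with w hw
      rw [hGm w hw, mul_div_cancel_left₀ _ (pow_ne_zero _ (hne w hw))]
    have hpow : HasDerivAt (fun w : ℂ => (w - p) ^ (k + 1)) ((k + 1) * (z - p) ^ k) z := by
      simpa using ((hasDerivAt_id z).sub_const p).fun_pow (k + 1)
    have hderiv := ((hG z).hasDerivAt.div hpow (pow_ne_zero _ (hne z hz))).congr_of_eventuallyEq heq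
    rw [iteratedDeriv_succ, hderiv.deriv]
    have := hne z hz
    field_simp
    ring

/-- For `m(z) = ∫₀^∞ x^{z-1} φ(x) x^{-p} dx` (with `φ` a cutoff function), the function
`(z - p)^{k+1} · m^{(k)}(z)` extends holomorphically from `{Re z > Re p}` to all of `ℂ`. -/
theorem mellin_cutoff_pow_deriv_entire_extension
    (φ : ℝ → ℝ) (hφ : ContDiff ℝ (⊤ : ℕ∞) φ)
    (hφ0 : ∀ x, 0 ≤ φ x) (hφ1 : ∀ x, φ x ≤ 1)
    (hφone : ∀ x : ℝ, x ≤ 1 → φ x = 1) (hφzero : ∀ x : ℝ, 2 ≤ x → φ x = 0)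
    (p : ℂ)
    (m : ℂ → ℂ)
    (hm : ∀ z : ℂ, m z = ∫ x in Ioi (0 : ℝ), (x : ℂ) ^ (z - 1) * ((φ x : ℂ) * (x : ℂ) ^ (-p)))
    (k : ℕ) :
    ∃ G : ℂ → ℂ, Differentiable ℂ G ∧
      ∀ z : ℂ, p.re < z.re → G z = (z - p) ^ (k + 1) * iteratedDeriv k m z := by
  set ψ : ℝ → ℂ := (Ioi (1 : ℝ)).indicator fun x => (φ x : ℂ) with hψ
  have hψ_loc : LocallyIntegrableOn ψ (Ioi 0) :=
    (((Complex.continuous_ofReal.comp hφ.continuous).locallyIntegrable.indicator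
      measurableSet_Ioi)).locallyIntegrableOn _
  have hψ_top : ∀ᶠ x in Filter.atTop, ψ x = 0 := by
    filter_upwards [Filter.eventually_ge_atTop (2 : ℝ)] with x hx
    simp [hψ, indicator_apply, hφzero x hx]
  have hψ_zero : ∀ᶠ x in nhdsWithin 0 (Ioi 0), ψ x = 0 := by
    filter_upwards [nhdsWithin_le_nhds (gt_mem_nhds (zero_lt_one' ℝ))] with x hx
    simp [hψ, hx.le]
  have hψ_mellin := differentiable_mellin_of_eventually_eq_zero hψ_loc hψ_top hψ_zero
  have hm_eq : ∀ z : ℂ, p.re < z.re → m z = 1 / (z - p) + mellin ψ (z - p) := by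
    intro z hz
    have h_one := hasMellin_one_Ioc (s := z - p) (by simpa using hz)
    rw [← h_one.2, ← (hasMellin_add h_one.1 (hψ_mellin (z - p)).1).2, hm z, mellin]
    refine setIntegral_congr_fun measurableSet_Ioi fun x (hx : 0 < x) => ?_
    have hx0 : (x : ℂ) ≠ 0 := by exact_mod_cast hx.ne'
    have hφx : (Ioc (0 : ℝ) 1).indicator (fun _ => (1 : ℂ)) x + ψ x = φ x := by
      rcases le_or_gt x 1 with h | h
      · simp [hψ, hx, h, hφone x h]
      · simp [hψ, h]
    have hpow : (x : ℂ) ^ (z - p - 1) = (x : ℂ) ^ (z - 1) * (x : ℂ) ^ (-p) := by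
      rw [← Complex.cpow_add _ _ hx0]
      ring_nf
    simp only [smul_eq_mul]
    rw [hφx, hpow]
    ring
  refine exists_entire_eq_pow_mul_iteratedDeriv (F := fun z => 1 + (z - p) * mellin ψ (z - p))
    ?_ (fun z hz => ?_) k
  · have hd : Differentiable ℂ (mellin ψ) := fun s => (hψ_mellin s).2
    have hd' : Differentiable ℂ fun z => mellin ψ (z - p) :=
      hd.comp (differentiable_id.sub_const p)
    fun_prop
  · have hne : z - p ≠ 0 := fun h0 => by
      rw [sub_eq_zero.mp h0] at hz
      exact lt_irrefl _ hz
    rw [hm_eq z hz]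
    field_simp
end

section
/- Let φ be a cutoff function and p ∈ ℂ, and let m : ℂ → ℂ be given by m(z) = ∫₀^∞ x^{z−1} φ(x) x^{−p} dx (so m is holomorphic on {z : Re z > Re p}). Then for every k ∈ ℕ and every r ∈ ℕ with 0 ≤ r ≤ k there exists an entire function G : ℂ → ℂ such that G(z) = ((−1)^k / k!) · (z − p)^r · m^{(k)}(z) − ((−1)^{k−r} / (k−r)!) · m^{(k−r)}(z) for all z with Re z > Re p; that is, this difference extends holomorphically to all of ℂ. -/
open Set MeasureTheory

open Filter Topology Asymptotics

/-- The Mellin transform of a locally integrable function vanishing near `0` and near `∞` is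
entire. -/
theorem differentiable_mellin_of_eventually_eq_zero_s6 {E : Type*} [NormedAddCommGroup E]
    [NormedSpace ℂ E] {f : ℝ → E} (hf : LocallyIntegrableOn f (Ioi 0))
    (h_top : f =ᶠ[atTop] 0) (h_zero : f =ᶠ[𝓝[>] 0] 0) : Differentiable ℂ (mellin f) := fun s ↦
  mellin_differentiableAt_of_isBigO_rpow (a := s.re + 1) (b := s.re - 1) hf
    (h_top.trans_isBigO (isBigO_zero _ _)) (by linarith)
    (h_zero.trans_isBigO (isBigO_zero _ _)) (by linarith)

theorem mellinConvergent_of_eventually_eq_zero {E : Type*} [NormedAddCommGroup E]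
    [NormedSpace ℂ E] {f : ℝ → E} (hf : LocallyIntegrableOn f (Ioi 0))
    (h_top : f =ᶠ[atTop] 0) (h_zero : f =ᶠ[𝓝[>] 0] 0) (s : ℂ) : MellinConvergent f s :=
  mellinConvergent_of_isBigO_rpow (a := s.re + 1) (b := s.re - 1) hf
    (h_top.trans_isBigO (isBigO_zero _ _)) (by linarith)
    (h_zero.trans_isBigO (isBigO_zero _ _)) (by linarith)

/-- The Mellin transform of a cutoff function times `x ^ (-p)` is a simple pole at `p` plus an
entire function. -/
theorem exists_entire_mellin_cutoff_eq {φ : ℝ → ℝ} (hφ : Continuous φ)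
    (hφone : ∀ x : ℝ, x ≤ 1 → φ x = 1) (hφzero : ∀ x : ℝ, 2 ≤ x → φ x = 0) (p : ℂ) :
    ∃ H : ℂ → ℂ, Differentiable ℂ H ∧ ∀ z : ℂ, p.re < z.re →
      mellin (fun x ↦ (φ x : ℂ) * (x : ℂ) ^ (-p)) z = (z - p)⁻¹ + H z := by
  set f : ℝ → ℂ := (Ioi 1).indicator fun x ↦ (φ x : ℂ) * (x : ℂ) ^ (-p) with hf_def
  have hf : LocallyIntegrableOn f (Ioi 0) := by
    have hcont : ContinuousOn (fun x : ℝ ↦ (φ x : ℂ) * (x : ℂ) ^ (-p)) (Ioi 0) := by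
      refine (Complex.continuous_ofReal.comp hφ).continuousOn.mul fun x hx ↦ ?_
      exact (Complex.continuousAt_ofReal_cpow_const x (-p)
        (Or.inr (ne_of_gt hx))).continuousWithinAt
    intro x hx
    obtain ⟨s, hs, hi⟩ :=
      hcont.locallyIntegrableOn (μ := volume) measurableSet_Ioi x hx
    exact ⟨s, hs, hi.indicator measurableSet_Ioi⟩
  have h_top : f =ᶠ[atTop] 0 := by
    filter_upwards [eventually_ge_atTop 2] with x hx
    simp [hf_def, indicator, hφzero x hx]
  have h_zero : f =ᶠ[𝓝[>] 0] 0 := by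
    filter_upwards [nhdsWithin_le_nhds (Iio_mem_nhds zero_lt_one)] with x hx
    exact indicator_of_notMem (not_lt.mpr (le_of_lt hx)) _
  refine ⟨mellin f, differentiable_mellin_of_eventually_eq_zero_s6 hf h_top h_zero, fun z hz ↦ ?_⟩
  have hpole := hasMellin_cpow_Ioc (-p) (s := z) (by simpa using hz)
  have hadd := (hasMellin_add hpole.1
    (mellinConvergent_of_eventually_eq_zero hf h_top h_zero z)).2
  rw [hpole.2, one_div, ← sub_eq_add_neg] at hadd
  rw [← hadd]
  refine setIntegral_congr_fun measurableSet_Ioi fun x hx ↦ ?_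
  have hx : 0 < x := hx
  rcases le_or_gt x 1 with h | h
  · simp [hf_def, indicator, hx, h, not_lt.mpr h, hφone x h]
  · simp [hf_def, indicator, h, not_le.mpr h]

theorem iteratedDeriv_inv_sub_const (n : ℕ) (p z : ℂ) :
    iteratedDeriv n (fun w ↦ (w - p)⁻¹) z =
      (-1) ^ n * (n.factorial : ℂ) * ((z - p) ^ (n + 1))⁻¹ := by
  have h := congr_fun (iter_deriv_inv_linear_sub n (1 : ℂ) p) z
  simp only [one_mul, one_pow, mul_one] at h
  rw [iteratedDeriv_eq_iterate, h, ← zpow_natCast (z - p), ← zpow_neg]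
  congr 2
  push_cast
  ring

/-- For `m(z) = ∫₀^∞ x^{z-1} φ(x) x^{-p} dx` (with `φ` a cutoff function) and `0 ≤ r ≤ k`,
the function `((-1)^k/k!) (z-p)^r m^{(k)}(z) - ((-1)^{k-r}/(k-r)!) m^{(k-r)}(z)` extends
holomorphically from `{Re z > Re p}` to all of `ℂ`. -/
theorem mellin_cutoff_pow_deriv_combination_entire_extension
    (φ : ℝ → ℝ) (hφ : ContDiff ℝ (⊤ : ℕ∞) φ)
    (hφ0 : ∀ x, 0 ≤ φ x) (hφ1 : ∀ x, φ x ≤ 1)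
    (hφone : ∀ x : ℝ, x ≤ 1 → φ x = 1) (hφzero : ∀ x : ℝ, 2 ≤ x → φ x = 0)
    (p : ℂ)
    (m : ℂ → ℂ)
    (hm : ∀ z : ℂ, m z = ∫ x in Ioi (0 : ℝ), (x : ℂ) ^ (z - 1) * ((φ x : ℂ) * (x : ℂ) ^ (-p)))
    (k r : ℕ) (hr : r ≤ k) :
    ∃ G : ℂ → ℂ, Differentiable ℂ G ∧
      ∀ z : ℂ, p.re < z.re →
        G z = ((-1) ^ k / (Nat.factorial k : ℂ)) * (z - p) ^ r * iteratedDeriv k m z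
          - ((-1) ^ (k - r) / (Nat.factorial (k - r) : ℂ)) * iteratedDeriv (k - r) m z := by
  obtain ⟨H, hH, hmH⟩ := exists_entire_mellin_cutoff_eq hφ.continuous hφone hφzero p
  have hHd (n : ℕ) : Differentiable ℂ (iteratedDeriv n H) :=
    hH.contDiff.differentiable_iteratedDeriv' n
  have hderiv (n : ℕ) (z : ℂ) (hz : p.re < z.re) : iteratedDeriv n m z =
      (-1) ^ n * (n.factorial : ℂ) * ((z - p) ^ (n + 1))⁻¹ + iteratedDeriv n H z := by
    have hzp : z - p ≠ 0 := sub_ne_zero.mpr fun h ↦ hz.ne (congrArg Complex.re h).symm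
    have heq : m =ᶠ[𝓝 z] fun w ↦ (w - p)⁻¹ + H w := by
      filter_upwards [(isOpen_lt continuous_const Complex.continuous_re).mem_nhds hz] with w hw
      rw [hm w, ← hmH w hw]
      rfl
    have hinv : ContDiffAt ℂ n (fun w ↦ (w - p)⁻¹) z :=
      (contDiffAt_id.sub contDiffAt_const).inv hzp
    rw [heq.iteratedDeriv_eq n, iteratedDeriv_fun_add hinv hH.contDiff.contDiffAt,
      iteratedDeriv_inv_sub_const]
  refine ⟨fun z ↦ ((-1) ^ k / (Nat.factorial k : ℂ)) * (z - p) ^ r * iteratedDeriv k H z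
    - ((-1) ^ (k - r) / (Nat.factorial (k - r) : ℂ)) * iteratedDeriv (k - r) H z, ?_,
    fun z hz ↦ ?_⟩
  · have h₁ := hHd k
    have h₂ := hHd (k - r)
    fun_prop
  · have hzp : z - p ≠ 0 := sub_ne_zero.mpr fun h ↦ hz.ne (congrArg Complex.re h).symm
    have hcoeff (n : ℕ) : (-1 : ℂ) ^ n / (n.factorial : ℂ) * ((-1) ^ n * (n.factorial : ℂ)) = 1 := by
      have hn : (n.factorial : ℂ) ≠ 0 := mod_cast n.factorial_ne_zero
      field_simp
      rw [← pow_mul, mul_comm, pow_mul, neg_one_sq, one_pow]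
    have hpow : (z - p) ^ r * ((z - p) ^ (k + 1))⁻¹ = ((z - p) ^ (k - r + 1))⁻¹ := by
      rw [show k + 1 = r + (k - r + 1) by omega, pow_add _ r]
      field_simp
    rw [hderiv k z hz, hderiv (k - r) z hz]
    linear_combination -((z - p) ^ r * ((z - p) ^ (k + 1))⁻¹) * hcoeff k
      + ((z - p) ^ (k - r + 1))⁻¹ * hcoeff (k - r) - hpow
end

section
/- Let γ ∈ ℝ and let u : ℝ → ℂ be continuous with compact support contained in (0,∞). Then ∫₀^∞ |u(x)|² x^{−2γ} dx = (1/(2π)) ∫_ℝ |(Mu)((1/2 − γ) + iτ)|² dτ, where (Mu)(z) = ∫₀^∞ x^{z−1} u(x) dx. -/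
open Set MeasureTheory Complex

open scoped FourierTransform in
/-- The Fourier transform on `L²` agrees almost everywhere with the Fourier integral for
functions in `L¹ ∩ L²`. -/
theorem coeFn_fourier_toLp_ae_eq {f : ℝ → ℂ} (hf : Integrable f) (hf2 : MemLp f 2) :
    (𝓕 (hf2.toLp f) : Lp ℂ 2 (volume : Measure ℝ)) =ᵐ[volume] 𝓕 f := by
  have hcont : Continuous (𝓕 f) :=
    VectorFourier.fourierIntegral_continuous Real.continuous_fourierChar continuous_inner hf
  refine ae_eq_of_integral_contDiff_smul_eq
    ((Lp.memLp (𝓕 (hf2.toLp f) : Lp ℂ 2 (volume : Measure ℝ))).locallyIntegrable (by norm_num))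
    hcont.locallyIntegrable fun g hg hgc ↦ ?_
  have hgc' : HasCompactSupport (Complex.ofRealCLM ∘ g) := hgc.comp_left rfl
  have hg' : ContDiff ℝ (⊤ : ℕ∞) (Complex.ofRealCLM ∘ g) :=
    Complex.ofRealCLM.contDiff.comp hg
  set φ : SchwartzMap ℝ ℂ := hgc'.toSchwartzMap hg'
  have hφ (x : ℝ) : φ x = g x := rfl
  have hself : ∫ x, 𝓕 φ x • f x = ∫ x, φ x • 𝓕 f x := by
    simpa using! VectorFourier.integral_fourierIntegral_smul_eq_flip (L := innerₗ ℝ)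
      Real.continuous_fourierChar continuous_inner φ.integrable hf
  have hdist := DFunLike.congr_fun (Lp.fourier_toTemperedDistribution_eq (hf2.toLp f)) φ
  rw [TemperedDistribution.fourier_apply, Lp.toTemperedDistribution_apply,
    Lp.toTemperedDistribution_apply] at hdist
  calc ∫ x, g x • (𝓕 (hf2.toLp f) : Lp ℂ 2 (volume : Measure ℝ)) x
      = ∫ x, 𝓕 φ x • hf2.toLp f x := by simpa [hφ] using hdist.symm
    _ = ∫ x, 𝓕 φ x • f x := by
      refine integral_congr_ae ?_
      filter_upwards [hf2.coeFn_toLp] with x hx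
      rw [hx]
    _ = ∫ x, g x • 𝓕 f x := by simpa [hφ] using hself

/-- The squared norm in `L²` as an integral. -/
theorem Lp_two_norm_sq_eq_integral (f : Lp ℂ 2 (volume : Measure ℝ)) :
    ‖f‖ ^ 2 = ∫ x, ‖f x‖ ^ 2 := by
  rw [← @inner_self_eq_norm_sq ℂ, L2.inner_def, ← integral_re (L2.integrable_inner f f)]
  simp only [inner_self_eq_norm_sq]

open scoped FourierTransform in
/-- Plancherel's identity for functions in `L¹ ∩ L²`. -/
theorem integral_norm_sq_fourier_eq {f : ℝ → ℂ} (hf : Integrable f) (hf2 : MemLp f 2) :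
    ∫ x, ‖𝓕 f x‖ ^ 2 = ∫ x, ‖f x‖ ^ 2 := by
  have h := congrArg (· ^ 2) (Lp.norm_fourier_eq (hf2.toLp f))
  simp only [Lp_two_norm_sq_eq_integral] at h
  calc ∫ x, ‖𝓕 f x‖ ^ 2
      = ∫ x, ‖(𝓕 (hf2.toLp f) : Lp ℂ 2 (volume : Measure ℝ)) x‖ ^ 2 := by
        refine integral_congr_ae ?_
        filter_upwards [coeFn_fourier_toLp_ae_eq hf hf2] with x hx
        rw [hx]
    _ = ∫ x, ‖hf2.toLp f x‖ ^ 2 := h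
    _ = ∫ x, ‖f x‖ ^ 2 := by
        refine integral_congr_ae ?_
        filter_upwards [hf2.coeFn_toLp] with x hx
        rw [hx]

/-- The change of variables `x = exp (-t)` in an integral over `(0, ∞)`. -/
theorem integral_Ioi_zero_eq_integral_exp_neg (f : ℝ → ℝ) :
    ∫ x in Ioi (0 : ℝ), f x = ∫ t : ℝ, Real.exp (-t) * f (Real.exp (-t)) := by
  have himage : (fun t : ℝ ↦ Real.exp (-t)) '' univ = Ioi 0 := by
    rw [image_univ, ← Real.range_exp]
    exact neg_surjective.range_comp Real.exp
  rw [← himage, integral_image_eq_integral_abs_deriv_smul MeasurableSet.univ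
    (f' := fun t ↦ -Real.exp (-t))
    (fun t _ ↦ (by simpa using (hasDerivAt_neg t).exp : HasDerivAt _ _ t).hasDerivWithinAt)
    (fun x _ y _ hxy ↦ neg_injective (Real.exp_injective hxy))]
  simp

/-- A function with compact support in `(0, ∞)` keeps compact support under `x = exp (-t)`. -/
theorem hasCompactSupport_comp_exp_neg {u : ℝ → ℂ} (hsupp : HasCompactSupport u)
    (hsupp' : tsupport u ⊆ Ioi (0 : ℝ)) : HasCompactSupport fun t ↦ u (Real.exp (-t)) := by
  have hlog : ContinuousOn (fun x : ℝ ↦ -Real.log x) (tsupport u) :=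
    (Real.continuousOn_log.mono fun x hx ↦ (hsupp' hx).ne').neg
  refine HasCompactSupport.intro (hsupp.isCompact.image_of_continuousOn hlog) fun t ht ↦ ?_
  by_contra hne
  exact ht ⟨Real.exp (-t), subset_tsupport u hne, by simp⟩

/-- Mellin–Plancherel theorem on the weight line `Γ_{1/2-γ}`, stated for compactly
supported continuous functions on `(0,∞)`:
`∫₀^∞ |u(x)|² x^{-2γ} dx = (1/2π) ∫_ℝ |(Mu)((1/2-γ)+iτ)|² dτ`. -/
theorem mellin_plancherel_weighted
    (γ : ℝ) (u : ℝ → ℂ)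
    (hu : Continuous u) (hsupp : HasCompactSupport u)
    (hsupp' : tsupport u ⊆ Ioi (0 : ℝ)) :
    ∫ x in Ioi (0 : ℝ), ‖u x‖ ^ 2 * x ^ (-2 * γ)
      = (1 / (2 * Real.pi)) *
          ∫ τ : ℝ, ‖mellin u ((((1 : ℝ) / 2 - γ : ℝ) : ℂ) + τ * I)‖ ^ 2 := by
  set g : ℝ → ℂ := fun t ↦ Real.exp (-(1 / 2 - γ) * t) • u (Real.exp (-t)) with hg
  have hgcont : Continuous g :=
    (Real.continuous_exp.comp (continuous_const.mul continuous_id)).smul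
      (hu.comp (Real.continuous_exp.comp continuous_neg))
  have hgsupp : HasCompactSupport g :=
    (hasCompactSupport_comp_exp_neg hsupp hsupp').mono
      fun t ht h ↦ ht (by simp only [hg, h, smul_zero])
  have hmellin (τ : ℝ) : mellin u ((((1 : ℝ) / 2 - γ : ℝ) : ℂ) + τ * I) =
      FourierTransform.fourier g (τ / (2 * Real.pi)) := by
    rw [mellin_eq_fourier]
    simp [hg]
  simp_rw [hmellin]
  rw [Measure.integral_comp_div (fun x ↦ ‖FourierTransform.fourier g x‖ ^ 2) (2 * Real.pi),
    integral_norm_sq_fourier_eq (hgcont.integrable_of_hasCompactSupport hgsupp)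
      (hgcont.memLp_of_hasCompactSupport hgsupp),
    integral_Ioi_zero_eq_integral_exp_neg, abs_of_pos Real.two_pi_pos, smul_eq_mul, ← mul_assoc,
    one_div_mul_cancel Real.two_pi_pos.ne', one_mul]
  congr 1 with t
  rw [hg, norm_smul, mul_pow, Real.norm_of_nonneg (Real.exp_nonneg _), ← Real.exp_mul,
    ← Real.exp_nat_mul, mul_left_comm, ← Real.exp_add, mul_comm]
  congr 2
  push_cast
  ring
end

section
/- Let γ ∈ ℝ, j ∈ ℕ, and let u : ℝ → ℂ be C^∞ with compact support contained in (0,∞). Define the operator D by (Du)(x) = x · u′(x), and let D^j u be its j-th iterate applied to u. Then ∫₀^∞ |(D^j u)(x)|² x^{−2γ} dx = (1/(2π)) ∫_ℝ ((1/2 − γ)² + τ²)^j · |(Mu)((1/2 − γ) + iτ)|² dτ, where (Mu)(z) = ∫₀^∞ x^{z−1} u(x) dx. -/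
open Set MeasureTheory Complex

open scoped FourierTransform ContDiff

/-- Iterates of the Euler derivative preserve smooth functions with compact support in `(0,∞)`. -/
lemma euler_iterate_contDiff_hasCompactSupport (j : ℕ) {u : ℝ → ℂ}
    (hu : ContDiff ℝ (⊤ : ℕ∞) u) (hsupp : HasCompactSupport u)
    (hsupp' : tsupport u ⊆ Ioi (0 : ℝ)) :
    ContDiff ℝ (⊤ : ℕ∞) ((fun (v : ℝ → ℂ) => fun x : ℝ => (x : ℂ) * deriv v x)^[j] u) ∧
      HasCompactSupport ((fun (v : ℝ → ℂ) => fun x : ℝ => (x : ℂ) * deriv v x)^[j] u) ∧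
      tsupport ((fun (v : ℝ → ℂ) => fun x : ℝ => (x : ℂ) * deriv v x)^[j] u) ⊆ Ioi 0 := by
  induction j with
  | zero => exact ⟨hu, hsupp, hsupp'⟩
  | succ j ih =>
    obtain ⟨hs, hc, ht⟩ := ih
    rw [Function.iterate_succ_apply']
    exact ⟨Complex.ofRealCLM.contDiff.mul (contDiff_infty_iff_deriv.mp hs).2,
      hc.deriv.mul_left, (tsupport_mul_subset_right.trans tsupport_deriv_subset).trans ht⟩

lemma integrable_cpow_mul {v : ℝ → ℂ} (hv : Continuous v) (hc : HasCompactSupport v)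
    (ht : tsupport v ⊆ Ioi (0 : ℝ)) (a : ℂ) :
    Integrable ((fun x : ℝ => (x : ℂ) ^ a) * v) := by
  refine Continuous.integrable_of_hasCompactSupport ?_ hc.mul_left
  refine continuous_of_tsupport fun x hx => ?_
  have hx0 : 0 < x := ht (tsupport_mul_subset_right hx)
  exact (continuousAt_ofReal_cpow_const x a (Or.inr hx0.ne')).mul hv.continuousAt

/-- The Mellin transform turns the Euler derivative into multiplication by `-s`. -/
lemma mellin_mul_deriv {v : ℝ → ℂ} (hv : ContDiff ℝ 1 v) (hc : HasCompactSupport v)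
    (ht : tsupport v ⊆ Ioi (0 : ℝ)) (s : ℂ) :
    mellin (fun x : ℝ => (x : ℂ) * deriv v x) s = -s * mellin v s := by
  have hd : Continuous (deriv v) := hv.continuous_deriv le_rfl
  have hpos {w : ℝ → ℂ} (hw : tsupport w ⊆ Ioi (0 : ℝ)) (a : ℂ) :
      ∫ x in Ioi (0 : ℝ), (x : ℂ) ^ a * w x = ∫ x : ℝ, (x : ℂ) ^ a * w x :=
    setIntegral_eq_integral_of_forall_compl_eq_zero fun x hx => by
      simp [image_eq_zero_of_notMem_tsupport fun h => hx (hw h)]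
  have htd : tsupport (deriv v) ⊆ Ioi 0 := tsupport_deriv_subset.trans ht
  have hIBP := integral_mul_deriv_eq_deriv_mul_of_integrable
    (u := fun x : ℝ => (x : ℂ) ^ s) (u' := fun x : ℝ => s * (x : ℂ) ^ (s - 1))
    (v := v) (v' := deriv v)
    (fun x hx => by
      simpa using (hasDerivAt_id (x : ℂ)).cpow_const (c := s)
        (Or.inl (by simpa using ht hx)) |>.comp_ofReal)
    (fun x _ => (hv.differentiable one_ne_zero x).hasDerivAt)
    (integrable_cpow_mul hd hc.deriv htd s)
    (by
      convert (integrable_cpow_mul hv.continuous hc ht (s - 1)).const_mul s using 2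
      simp [mul_assoc])
    (integrable_cpow_mul hv.continuous hc ht s)
  calc mellin (fun x : ℝ => (x : ℂ) * deriv v x) s
      = ∫ x in Ioi (0 : ℝ), (x : ℂ) ^ s * deriv v x := by
        refine setIntegral_congr_fun measurableSet_Ioi fun x hx => ?_
        have hx0 : (x : ℂ) ≠ 0 := ofReal_ne_zero.mpr (ne_of_gt hx)
        simp only [smul_eq_mul, cpow_sub _ _ hx0, cpow_one]
        field_simp
    _ = -s * mellin v s := by
        rw [hpos htd, hIBP]
        simp only [mellin, smul_eq_mul, hpos ht, mul_assoc, integral_const_mul]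
        ring

lemma mellin_euler_iterate (j : ℕ) {u : ℝ → ℂ}
    (hu : ContDiff ℝ (⊤ : ℕ∞) u) (hsupp : HasCompactSupport u)
    (hsupp' : tsupport u ⊆ Ioi (0 : ℝ)) (s : ℂ) :
    mellin ((fun (v : ℝ → ℂ) => fun x : ℝ => (x : ℂ) * deriv v x)^[j] u) s =
      (-s) ^ j * mellin u s := by
  induction j with
  | zero => simp
  | succ j ih =>
    obtain ⟨hs, hc, ht⟩ := euler_iterate_contDiff_hasCompactSupport j hu hsupp hsupp'
    rw [Function.iterate_succ_apply', mellin_mul_deriv (hs.of_le (by simp)) hc ht, ih]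
    ring

lemma integral_comp_exp_neg {E : Type*} [NormedAddCommGroup E] [NormedSpace ℝ E] (h : ℝ → E) :
    ∫ w : ℝ, Real.exp (-w) • h (Real.exp (-w)) = ∫ x in Ioi (0 : ℝ), h x := by
  rw [integral_neg_eq_self (fun w : ℝ => Real.exp w • h (Real.exp w)), ← Real.range_exp,
    ← image_univ]
  simpa using (integral_image_eq_integral_abs_deriv_smul MeasurableSet.univ
    (fun x _ => (Real.hasDerivAt_exp x).hasDerivWithinAt) Real.exp_injective.injOn h).symm

/-- Mellin–Plancherel for smooth functions with compact support in `(0,∞)`. -/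
lemma mellin_plancherel (γ : ℝ) {f : ℝ → ℂ}
    (hf : ContDiff ℝ (⊤ : ℕ∞) f) (hc : HasCompactSupport f)
    (ht : tsupport f ⊆ Ioi (0 : ℝ)) :
    ∫ x in Ioi (0 : ℝ), ‖f x‖ ^ 2 * x ^ (-2 * γ) =
      (1 / (2 * Real.pi)) *
        ∫ τ : ℝ, ‖mellin f ((((1 : ℝ) / 2 - γ : ℝ) : ℂ) + τ * I)‖ ^ 2 := by
  set c : ℝ := 1 / 2 - γ with hcdef
  set g : ℝ → ℂ := fun w => Real.exp (-c * w) • f (Real.exp (-w)) with hg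
  have hgs : ContDiff ℝ ∞ g :=
    (Real.contDiff_exp.comp (contDiff_const.mul contDiff_id)).smul
      (hf.comp (Real.contDiff_exp.comp contDiff_neg))
  have hgc : HasCompactSupport g := by
    refine HasCompactSupport.intro (K := (fun x => -Real.log x) '' tsupport f)
      (hc.isCompact.image_of_continuousOn
        (Real.continuousOn_log.mono fun x hx => (ne_of_gt (ht hx) : x ≠ 0)).neg) fun w hw => ?_
    have : f (Real.exp (-w)) = 0 :=
      image_eq_zero_of_notMem_tsupport fun h => hw ⟨_, h, by simp⟩
    simp [hg, this]
  have hP : ∫ ξ, ‖𝓕 g ξ‖ ^ 2 = ∫ w, ‖g w‖ ^ 2 := by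
    simpa [SchwartzMap.fourier_coe] using!
      SchwartzMap.integral_norm_sq_fourier (hgc.toSchwartzMap hgs)
  have hM (τ : ℝ) : mellin f ((c : ℂ) + τ * I) = 𝓕 g (τ / (2 * Real.pi)) := by
    rw [mellin_eq_fourier]
    simp [hg]
  simp_rw [hM]
  rw [Measure.integral_comp_div (fun ξ => ‖𝓕 g ξ‖ ^ 2), hP, ← integral_comp_exp_neg,
    abs_of_pos Real.two_pi_pos, smul_eq_mul, ← mul_assoc,
    one_div_mul_cancel Real.two_pi_pos.ne', one_mul]
  congr with w
  have he : Real.exp (-w) * Real.exp (-w * (-2 * γ)) = Real.exp (-c * w) ^ 2 := by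
    rw [← Real.exp_add, ← Real.exp_nat_mul, hcdef]
    push_cast
    ring_nf
  rw [hg, norm_smul, mul_pow, Real.norm_of_nonneg (Real.exp_pos _).le, ← he, ← Real.exp_mul,
    smul_eq_mul]
  ring

/-- Mellin–Plancherel for iterates of the totally characteristic derivative `D = x·∂ₓ`:
`∫₀^∞ |(Dʲu)(x)|² x^{-2γ} dx = (1/2π) ∫_ℝ ((1/2-γ)² + τ²)ʲ |(Mu)((1/2-γ)+iτ)|² dτ`
for `u` smooth and compactly supported in `(0,∞)`. -/
theorem mellin_plancherel_weighted_euler_iterate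
    (γ : ℝ) (j : ℕ) (u : ℝ → ℂ)
    (hu : ContDiff ℝ (⊤ : ℕ∞) u) (hsupp : HasCompactSupport u)
    (hsupp' : tsupport u ⊆ Ioi (0 : ℝ)) :
    ∫ x in Ioi (0 : ℝ),
        ‖((fun (v : ℝ → ℂ) => fun x : ℝ => (x : ℂ) * deriv v x)^[j] u) x‖ ^ 2 * x ^ (-2 * γ)
      = (1 / (2 * Real.pi)) *
          ∫ τ : ℝ, (((1 : ℝ) / 2 - γ) ^ 2 + τ ^ 2) ^ j *
            ‖mellin u ((((1 : ℝ) / 2 - γ : ℝ) : ℂ) + τ * I)‖ ^ 2 := by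
  obtain ⟨hs, hc, ht⟩ := euler_iterate_contDiff_hasCompactSupport j hu hsupp hsupp'
  rw [mellin_plancherel γ hs hc ht]
  congr 2 with τ
  rw [mellin_euler_iterate j hu hsupp hsupp', norm_mul, norm_pow, norm_neg, mul_pow, pow_right_comm,
    Complex.sq_norm, normSq_add_mul_I]
end

section
/- Let d ≥ 0, δ ∈ ℝ, and let u, v : (0,∞) × ℝ^d → ℂ be C¹ functions such that the four functions (x,y) ↦ x^{−δ} u(x,y), (x,y) ↦ x^{−δ}·x·∂ₓu(x,y), (x,y) ↦ x^{−δ} v(x,y), and (x,y) ↦ x^{−δ}·x·∂ₓv(x,y) are all square-integrable on (0,∞) × ℝ^d (with respect to dx dy). Then all integrands below are integrable and ∫_{(0,∞)×ℝ^d} (x·∂ₓu)(x,y) · conj(v(x,y)) · x^{−2δ} dx dy = −∫_{(0,∞)×ℝ^d} u(x,y) · conj((x·∂ₓv)(x,y)) · x^{−2δ} dx dy − (1 − 2δ) ∫_{(0,∞)×ℝ^d} u(x,y) · conj(v(x,y)) · x^{−2δ} dx dy. In particular, integration by parts in the totally characteristic derivative x∂ₓ produces no boundary terms at x = 0 or x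 = ∞. -/
open Set MeasureTheory

/-- If `g'` is the derivative of `x * h x` on `(0, ∞)` and both `g'` and `h` are integrable there,
then `∫ g' = 0`: no boundary terms appear at `0` or `∞`. -/
theorem integral_Ioi_zero_eq_zero_of_hasDerivAt_of_integrableOn_mul {g' h : ℝ → ℂ}
    (hderiv : ∀ x ∈ Ioi (0 : ℝ), HasDerivAt (fun t : ℝ => (t : ℂ) * h t) (g' x) x)
    (hg' : IntegrableOn g' (Ioi 0)) (hh : IntegrableOn h (Ioi 0)) :
    ∫ x in Ioi (0 : ℝ), g' x = 0 := by
  have himg : Real.exp '' univ = Ioi 0 := by rw [image_univ, Real.range_exp]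
  have hexp (x : ℝ) (_ : x ∈ univ) : HasDerivWithinAt Real.exp (Real.exp x) univ x :=
    (Real.hasDerivAt_exp x).hasDerivWithinAt
  have hinj : InjOn Real.exp univ := Real.exp_injective.injOn
  rw [← himg, integrableOn_image_iff_integrableOn_abs_deriv_smul MeasurableSet.univ hexp hinj,
    integrableOn_univ] at hg' hh
  rw [← himg, integral_image_eq_integral_abs_deriv_smul MeasurableSet.univ hexp hinj,
    setIntegral_univ]
  refine integral_eq_zero_of_hasDerivAt_of_integrable
    (f := fun t => |Real.exp t| • h (Real.exp t)) (fun t => ?_) hg' hh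
  have key := (hderiv (Real.exp t) (Real.exp_pos t)).scomp t (Real.hasDerivAt_exp t)
  simpa [Function.comp_def, abs_of_pos (Real.exp_pos _)] using key

theorem integrableOn_mul_conj_mul_weight {α : Type*} [MeasurableSpace α] {μ : Measure α}
    {s : Set α} (hs : MeasurableSet s) {a b : α → ℂ} {w : α → ℝ} (hw : ∀ q ∈ s, 0 ≤ w q)
    (ham : AEStronglyMeasurable a (μ.restrict s)) (hbm : AEStronglyMeasurable b (μ.restrict s))
    (hwm : AEStronglyMeasurable w (μ.restrict s))
    (ha : IntegrableOn (fun q => ‖a q‖ ^ 2 * w q) s μ)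
    (hb : IntegrableOn (fun q => ‖b q‖ ^ 2 * w q) s μ) :
    IntegrableOn (fun q => a q * starRingEnd ℂ (b q) * (w q : ℂ)) s μ := by
  refine Integrable.mono' (ha.add hb) ((ham.mul
    (Complex.continuous_conj.comp_aestronglyMeasurable hbm)).mul
      (Complex.continuous_ofReal.comp_aestronglyMeasurable hwm)) ?_
  filter_upwards [ae_restrict_mem hs] with q hq
  have h₀ := hw q hq
  simp only [norm_mul, RCLike.norm_conj, Complex.norm_real, Real.norm_of_nonneg h₀, Pi.add_apply]
  rw [← add_mul]
  gcongr
  nlinarith [sq_nonneg (‖a q‖ - ‖b q‖), sq_nonneg (‖a q‖ + ‖b q‖)]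

theorem setIntegral_Ioi_prod_univ_eq_zero {E : Type*} [MeasureSpace E]
    [SFinite (volume : Measure E)] {G H : ℝ × E → ℂ}
    (hderiv : ∀ y, ∀ x ∈ Ioi (0 : ℝ), HasDerivAt (fun t : ℝ => (t : ℂ) * H (t, y)) (G (x, y)) x)
    (hG : IntegrableOn G (Ioi 0 ×ˢ univ)) (hH : IntegrableOn H (Ioi 0 ×ˢ univ)) :
    ∫ q in Ioi (0 : ℝ) ×ˢ (univ : Set E), G q = 0 := by
  have hvol : (volume : Measure (ℝ × E)).restrict (Ioi 0 ×ˢ univ) =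
      (volume.restrict (Ioi 0)).prod volume := by
    rw [Measure.volume_eq_prod, ← Measure.prod_restrict, Measure.restrict_univ]
  rw [IntegrableOn, hvol] at hG hH
  rw [hvol, integral_prod_symm _ hG]
  refine integral_eq_zero_of_ae ?_
  filter_upwards [hG.prod_left_ae, hH.prod_left_ae] with y hGy hHy
  exact integral_Ioi_zero_eq_zero_of_hasDerivAt_of_integrableOn_mul (hderiv y) hGy hHy

theorem hasDerivAt_slice_fst {E F : Type*} [NormedAddCommGroup E] [NormedSpace ℝ E]
    [NormedAddCommGroup F] [NormedSpace ℝ F] {u : ℝ × E → F} {x : ℝ} {y : E}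
    (hu : DifferentiableAt ℝ u (x, y)) :
    HasDerivAt (fun t => u (t, y)) (fderiv ℝ u (x, y) (1, 0)) x :=
  hu.hasFDerivAt.comp_hasDerivAt x ((hasDerivAt_id x).prodMk (hasDerivAt_const x y))

theorem hasDerivAt_mul_mul_conj_mul_rpow {a b : ℝ → ℂ} {a' b' : ℂ} {x : ℝ} (hx : 0 < x)
    (ha : HasDerivAt a a' x) (hb : HasDerivAt b b' x) (δ : ℝ) :
    HasDerivAt (fun t : ℝ => (t : ℂ) * (a t * starRingEnd ℂ (b t) * ((t ^ (-2 * δ) : ℝ) : ℂ)))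
      (x * a' * starRingEnd ℂ (b x) * ((x ^ (-2 * δ) : ℝ) : ℂ) +
        a x * starRingEnd ℂ (x * b') * ((x ^ (-2 * δ) : ℝ) : ℂ) +
        (1 - 2 * δ) * (a x * starRingEnd ℂ (b x) * ((x ^ (-2 * δ) : ℝ) : ℂ))) x := by
  have hw := (Real.hasDerivAt_rpow_const (p := -2 * δ) (Or.inl hx.ne')).ofReal_comp
  have hid := (hasDerivAt_id x).ofReal_comp
  refine (hid.mul ((ha.mul hb.star).mul hw)).congr_deriv ?_
  have hpow : ((x ^ (-2 * δ) : ℝ) : ℂ) = x * ((x ^ (-2 * δ - 1) : ℝ) : ℂ) := by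
    rw [← Complex.ofReal_mul, Real.rpow_sub_one hx.ne', mul_div_cancel₀ _ hx.ne']
  simp only [id, map_mul, Pi.mul_apply, starRingEnd_apply, hpow]
  push_cast
  simp
  ring

/-- Integration by parts for the totally characteristic derivative `x∂ₓ` in the weighted
space `𝒦^{0,δ}` produces no boundary terms at `x = 0` or `x = ∞`:
`⟨x∂ₓu, v⟩ = −⟨u, x∂ₓv⟩ − (1−2δ)⟨u, v⟩` in `L²((0,∞)×ℝ^d, x^{−2δ} dx dy)`. -/
theorem integrationByParts_euler_weighted
    (d : ℕ) (δ : ℝ)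
    (u v : ℝ × EuclideanSpace ℝ (Fin d) → ℂ)
    (hu : ContDiffOn ℝ 1 u (Ioi 0 ×ˢ univ))
    (hv : ContDiffOn ℝ 1 v (Ioi 0 ×ˢ univ))
    (hu₂ : IntegrableOn (fun q : ℝ × EuclideanSpace ℝ (Fin d) =>
      ‖u q‖ ^ 2 * q.1 ^ (-2 * δ)) (Ioi 0 ×ˢ univ))
    (hux₂ : IntegrableOn (fun q : ℝ × EuclideanSpace ℝ (Fin d) =>
      ‖(q.1 : ℂ) * fderiv ℝ u q ((1 : ℝ), (0 : EuclideanSpace ℝ (Fin d)))‖ ^ 2 *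
        q.1 ^ (-2 * δ)) (Ioi 0 ×ˢ univ))
    (hv₂ : IntegrableOn (fun q : ℝ × EuclideanSpace ℝ (Fin d) =>
      ‖v q‖ ^ 2 * q.1 ^ (-2 * δ)) (Ioi 0 ×ˢ univ))
    (hvx₂ : IntegrableOn (fun q : ℝ × EuclideanSpace ℝ (Fin d) =>
      ‖(q.1 : ℂ) * fderiv ℝ v q ((1 : ℝ), (0 : EuclideanSpace ℝ (Fin d)))‖ ^ 2 *
        q.1 ^ (-2 * δ)) (Ioi 0 ×ˢ univ)) :
    (IntegrableOn (fun q : ℝ × EuclideanSpace ℝ (Fin d) =>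
        (q.1 : ℂ) * fderiv ℝ u q ((1 : ℝ), (0 : EuclideanSpace ℝ (Fin d))) *
          starRingEnd ℂ (v q) * ((q.1 ^ (-2 * δ) : ℝ) : ℂ)) (Ioi 0 ×ˢ univ)) ∧
    (IntegrableOn (fun q : ℝ × EuclideanSpace ℝ (Fin d) =>
        u q * starRingEnd ℂ ((q.1 : ℂ) *
          fderiv ℝ v q ((1 : ℝ), (0 : EuclideanSpace ℝ (Fin d)))) *
            ((q.1 ^ (-2 * δ) : ℝ) : ℂ)) (Ioi 0 ×ˢ univ)) ∧
    (IntegrableOn (fun q : ℝ × EuclideanSpace ℝ (Fin d) =>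
        u q * starRingEnd ℂ (v q) * ((q.1 ^ (-2 * δ) : ℝ) : ℂ)) (Ioi 0 ×ˢ univ)) ∧
    ∫ q in (Ioi 0 ×ˢ univ : Set (ℝ × EuclideanSpace ℝ (Fin d))),
        (q.1 : ℂ) * fderiv ℝ u q ((1 : ℝ), (0 : EuclideanSpace ℝ (Fin d))) *
          starRingEnd ℂ (v q) * ((q.1 ^ (-2 * δ) : ℝ) : ℂ)
      = -(∫ q in (Ioi 0 ×ˢ univ : Set (ℝ × EuclideanSpace ℝ (Fin d))),
            u q * starRingEnd ℂ ((q.1 : ℂ) *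
              fderiv ℝ v q ((1 : ℝ), (0 : EuclideanSpace ℝ (Fin d)))) *
                ((q.1 ^ (-2 * δ) : ℝ) : ℂ))
        - (1 - 2 * δ) * ∫ q in (Ioi 0 ×ˢ univ : Set (ℝ × EuclideanSpace ℝ (Fin d))),
            u q * starRingEnd ℂ (v q) * ((q.1 ^ (-2 * δ) : ℝ) : ℂ) := by
  have hopen : IsOpen (Ioi 0 ×ˢ univ : Set (ℝ × EuclideanSpace ℝ (Fin d))) :=
    isOpen_Ioi.prod isOpen_univ
  have hms := hopen.measurableSet
  have hmeas {F : ℝ × EuclideanSpace ℝ (Fin d) → ℂ} (hF : ContinuousOn F (Ioi 0 ×ˢ univ)) :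
      AEStronglyMeasurable F (volume.restrict (Ioi 0 ×ˢ univ)) :=
    hF.aestronglyMeasurable hms
  have hx_deriv {f : ℝ × EuclideanSpace ℝ (Fin d) → ℂ} (hf : ContDiffOn ℝ 1 f (Ioi 0 ×ˢ univ)) :
      ContinuousOn (fun q => (q.1 : ℂ) * fderiv ℝ f q ((1 : ℝ), (0 : EuclideanSpace ℝ (Fin d))))
        (Ioi 0 ×ˢ univ) :=
    (Complex.continuous_ofReal.comp continuous_fst).continuousOn.mul
      ((hf.continuousOn_fderiv_of_isOpen hopen le_rfl).clm_apply continuousOn_const)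
  have hw : ∀ q ∈ (Ioi 0 ×ˢ univ : Set (ℝ × EuclideanSpace ℝ (Fin d))), 0 ≤ q.1 ^ (-2 * δ) :=
    fun q hq => Real.rpow_nonneg (le_of_lt hq.1) _
  have hwm : AEStronglyMeasurable (fun q : ℝ × EuclideanSpace ℝ (Fin d) => q.1 ^ (-2 * δ))
      (volume.restrict (Ioi 0 ×ˢ univ)) :=
    (measurable_fst.pow_const _).aestronglyMeasurable
  have h₁ := integrableOn_mul_conj_mul_weight hms hw (hmeas (hx_deriv hu))
    (hmeas hv.continuousOn) hwm hux₂ hv₂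
  have h₂ := integrableOn_mul_conj_mul_weight hms hw (hmeas hu.continuousOn)
    (hmeas (hx_deriv hv)) hwm hu₂ hvx₂
  have h₃ := integrableOn_mul_conj_mul_weight hms hw (hmeas hu.continuousOn)
    (hmeas hv.continuousOn) hwm hu₂ hv₂
  refine ⟨h₁, h₂, h₃, ?_⟩
  have hdiff {f : ℝ × EuclideanSpace ℝ (Fin d) → ℂ} (hf : ContDiffOn ℝ 1 f (Ioi 0 ×ˢ univ))
      (y : EuclideanSpace ℝ (Fin d)) {x : ℝ} (hx : x ∈ Ioi (0 : ℝ)) :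
      DifferentiableAt ℝ f (x, y) :=
    (hf.contDiffAt (hopen.mem_nhds ⟨hx, mem_univ y⟩)).differentiableAt one_ne_zero
  have h₀ := setIntegral_Ioi_prod_univ_eq_zero
    (fun y x hx => hasDerivAt_mul_mul_conj_mul_rpow hx (hasDerivAt_slice_fst (hdiff hu y hx))
      (hasDerivAt_slice_fst (hdiff hv y hx)) δ)
    ((h₁.add h₂).add (h₃.const_mul (1 - 2 * (δ : ℂ)))) h₃
  rw [integral_add' (h₁.add h₂) (h₃.const_mul _), integral_add' h₁ h₂, integral_const_mul] at h₀
  linear_combination h₀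
end
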